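/- Assume k = ℂ and Q, q are generic. Then for each 1 ≤ i ≤ d, the operator K_i on V_n^{⊗d} is diagonalizable. -/

import Mathlib

noncomputable section
namespace QSP

variable {k : Type*} [Field k]

/-- Doubled value of a basis index: `val n j = 2*j - (n-1)`, so that the basis
indices of `V_n` are the integers/half-integers `val/2` in `𝕀_n`. -/
def val (n : ℕ) (j : Fin n) : ℤ := 2 * (j : ℤ) - ((n : ℤ) - 1)

/-- Matrix of the operator `K_Q` on `V_n` in the standard basis. -/
def KQmat (Q : k) (n : ℕ) : Matrix (Fin n) (Fin n) k := fun c b =>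
  if val n b = 0 then (if c = b then Q⁻¹ else 0)
  else (if c = Fin.rev b then 1 else 0) + (if val n b < 0 ∧ c = b then Q⁻¹ - Q else 0)

/-- Matrix of the operator `R_q` on `V_n ⊗ V_n` in the standard basis. -/
def Rmat (q : k) (n : ℕ) : Matrix (Fin n × Fin n) (Fin n × Fin n) k := fun c b =>
  if b.1 = b.2 then (if c = b then q⁻¹ else 0)
  else if b.1 < b.2 then (if c = (b.2, b.1) then 1 else 0)
  else (if c = (b.2, b.1) then 1 else 0) + (if c = b then q⁻¹ - q else 0)

/-- The operators `T_i`, `0 ≤ i ≤ d-1`, on `V_n^{⊗ d}`; `T_0` acts as `K_Q` on the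
first tensor factor, and `T_i` (for `i > 0`) acts as `R_q` on the `(i, i+1)`
tensor factors (1-based). -/
def TB (Q q : k) (n d : ℕ) (i : ℕ) : Module.End k ((Fin d → Fin n) → k) :=
  if _h0 : i = 0 then
    if hd : 0 < d then
      Matrix.toLin' (fun c b =>
        if ∀ j, j ≠ (⟨0, hd⟩ : Fin d) → c j = b j then
          KQmat Q n (c ⟨0, hd⟩) (b ⟨0, hd⟩) else 0)
    else 0
  else if hi : i < d then
    Matrix.toLin' (fun c b =>
      if ∀ j, j ≠ (⟨i - 1, Nat.lt_of_le_of_lt (Nat.pred_le i) hi⟩ : Fin d) →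
          j ≠ (⟨i, hi⟩ : Fin d) → c j = b j then
        Rmat q n (c ⟨i - 1, Nat.lt_of_le_of_lt (Nat.pred_le i) hi⟩, c ⟨i, hi⟩)
          (b ⟨i - 1, Nat.lt_of_le_of_lt (Nat.pred_le i) hi⟩, b ⟨i, hi⟩) else 0)
  else 0

/-- The Jucys–Murphy elements `K_i = T_{i-1} ⋯ T_1 T_0 T_1 ⋯ T_{i-1}` acting on
`V_n^{⊗ d}`, for `1 ≤ i ≤ d` (junk value `1` for `i = 0`). -/
def JM (Q q : k) (n d : ℕ) : ℕ → Module.End k ((Fin d → Fin n) → k)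
  | 0 => 1
  | 1 => TB Q q n d 0
  | i + 2 => TB Q q n d (i + 1) * JM Q q n d (i + 1) * TB Q q n d (i + 1)

/-- The element `c_K = K_1 K_2 ⋯ K_d` acting on `V_n^{⊗ d}`. -/
def cK (Q q : k) (n d : ℕ) : Module.End k ((Fin d → Fin n) → k) :=
  ((List.range d).map (fun i => JM Q q n d (i + 1))).prod



def a0 (Q : k) (n : ℕ) (x : Fin n) : k :=
  if val n x = 0 then Q⁻¹ else if val n x < 0 then Q⁻¹ - Q else 0

def b0 (k : Type*) [Field k] (n : ℕ) (x : Fin n) : k := if val n x = 0 then 0 else 1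

def a1 (q : k) {n : ℕ} (x y : Fin n) : k :=
  if x = y then q⁻¹ else if y < x then q⁻¹ - q else 0

def b1 (k : Type*) [Field k] {n : ℕ} (x y : Fin n) : k := if x = y then 0 else 1

lemma val_rev (n : ℕ) (x : Fin n) : val n (Fin.rev x) = - val n x := by
  have := x.2
  simp only [val, Fin.val_rev]
  omega

lemma val_inj {n : ℕ} {x y : Fin n} : x = y ↔ val n x = val n y := by
  simp only [val, Fin.ext_iff]
  omega

lemma val_lt {n : ℕ} {x y : Fin n} : x < y ↔ val n x < val n y := by
  simp only [val, Fin.lt_def]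
  omega

lemma KQ_entry (Q : k) (n : ℕ) (x y : Fin n) :
    KQmat Q n x y = (if y = x then a0 Q n x else 0) + (if y = Fin.rev x then b0 k n x else 0) := by
  have h1 : x = Fin.rev y ↔ y = Fin.rev x := by
    rw [val_inj, val_inj, val_rev, val_rev]; omega
  have h2 := val_rev n x
  by_cases hxy : y = x
  · subst hxy
    by_cases h : val n y = 0
    · simp [KQmat, a0, b0, h]
    · simp [KQmat, a0, b0, h, add_comm]
  · by_cases h : y = Fin.rev x
    · subst h
      by_cases h3 : val n x = 0
      · exfalso; apply hxy; rw [val_inj]; omega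
      · simp [KQmat, b0, h3, hxy, Ne.symm hxy, val_rev]
    · simp [KQmat, h, hxy, Ne.symm hxy, h1]

lemma R_entry (q : k) (n : ℕ) (x y x' y' : Fin n) :
    Rmat q n (x, y) (x', y') = (if x' = x ∧ y' = y then a1 q x y else 0) +
      (if x' = y ∧ y' = x then b1 k x y else 0) := by
  unfold Rmat a1 b1
  simp only [Prod.mk.injEq]
  grind

/-- The operator in functional form. -/
def Op {X : Type*} (a b : X → k) (s : X → X) : Module.End k (X → k) where
  toFun f c := a c * f c + b c * f (s c)
  map_add' f g := by ext c; simp; ring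
  map_smul' r f := by ext c; simp; ring

lemma Op_apply {X : Type*} (a b : X → k) (s : X → X) (f : X → k) (c : X) :
    Op a b s f c = a c * f c + b c * f (s c) := rfl

def Kop (Q : k) (n : ℕ) {d : ℕ} (p : Fin d) : Module.End k ((Fin d → Fin n) → k) :=
  Op (fun c => a0 Q n (c p)) (fun c => b0 k n (c p)) (fun c => Function.update c p (Fin.rev (c p)))

def Rop (q : k) (n : ℕ) {d : ℕ} (p r : Fin d) : Module.End k ((Fin d → Fin n) → k) :=
  Op (fun c => a1 q (c p) (c r)) (fun c => b1 k (c p) (c r)) (fun c => c ∘ Equiv.swap p r)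

lemma toLin_Op {X : Type*} [Fintype X] [DecidableEq X] (a b : X → k) (s : X → X)
    (M : Matrix X X k)
    (h : ∀ c x, M c x = (if x = c then a c else 0) + (if x = s c then b c else 0)) :
    Matrix.toLin' M = Op a b s := by
  refine LinearMap.ext fun F => funext fun c => ?_
  simp [Op_apply, Matrix.mulVec, dotProduct, h, add_mul, Finset.sum_add_distrib]

lemma TB_zero (Q q : k) (n d : ℕ) (hd : 0 < d) : TB Q q n d 0 = Kop Q n ⟨0, hd⟩ := by
  unfold TB
  rw [dif_pos rfl, dif_pos hd]
  apply toLin_Op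
  intro c x
  rw [KQ_entry]
  generalize (⟨0, hd⟩ : Fin d) = p
  by_cases h : ∀ j, j ≠ p → c j = x j
  · rw [if_pos h]
    have h1 : x = c ↔ x p = c p := by
      constructor
      · rintro rfl; rfl
      · intro h'; funext j
        by_cases hj : j = p
        · subst hj; exact h'
        · exact (h j hj).symm
    have h2 : x = Function.update c p (Fin.rev (c p)) ↔ x p = Fin.rev (c p) := by
      constructor
      · intro h'; rw [h']; simp
      · intro h'; funext j
        by_cases hj : j = p
        · subst hj; simp [h']
        · simp [hj, h j hj]
    simp only [h1, h2]
  · rw [if_neg h, if_neg, if_neg, add_zero]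
    · rintro rfl; apply h; intro j hj; simp [hj]
    · rintro rfl; exact h (fun _ _ => rfl)

lemma TB_pos (Q q : k) (n d i : ℕ) (h0 : i ≠ 0) (hi : i < d) :
    TB Q q n d i = Rop q n ⟨i - 1, Nat.lt_of_le_of_lt (Nat.pred_le i) hi⟩ ⟨i, hi⟩ := by
  unfold TB
  rw [dif_neg h0, dif_pos hi]
  apply toLin_Op
  intro c x
  rw [R_entry]
  have hpr : (⟨i - 1, Nat.lt_of_le_of_lt (Nat.pred_le i) hi⟩ : Fin d) ≠ ⟨i, hi⟩ := by
    simp; omega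
  revert hpr
  generalize (⟨i - 1, Nat.lt_of_le_of_lt (Nat.pred_le i) hi⟩ : Fin d) = p
  generalize (⟨i, hi⟩ : Fin d) = r
  intro hpr
  by_cases h : ∀ j, j ≠ p → j ≠ r → c j = x j
  · rw [if_pos h]
    have h1 : x = c ↔ x p = c p ∧ x r = c r := by
      constructor
      · rintro rfl; exact ⟨rfl, rfl⟩
      · intro h'; funext j
        by_cases hj : j = p
        · subst hj; exact h'.1
        · by_cases hj' : j = r
          · subst hj'; exact h'.2
          · exact (h j hj hj').symm
    have h2 : x = c ∘ Equiv.swap p r ↔ x p = c r ∧ x r = c p := by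
      constructor
      · intro h'; rw [h']; simp
      · intro h'; funext j
        by_cases hj : j = p
        · subst hj; simp [h']
        · by_cases hj' : j = r
          · subst hj'; simp [h']
          · simp [Equiv.swap_apply_of_ne_of_ne hj hj', h j hj hj']
    simp only [h1, h2]
  · rw [if_neg h, if_neg, if_neg, add_zero]
    · rintro rfl; apply h; intro j hj hj'; simp [Equiv.swap_apply_of_ne_of_ne hj hj']
    · rintro rfl; exact h (fun _ _ _ => rfl)

lemma Rop_quad (q : k) (hq : q ≠ 0) (n : ℕ) {d : ℕ} (p r : Fin d) :
    Rop q n p r * Rop q n p r = 1 + (q⁻¹ - q) • Rop q n p r := by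
  refine LinearMap.ext fun F => funext fun c => ?_
  simp only [Rop, Module.End.mul_apply, Op_apply, LinearMap.add_apply,
    LinearMap.smul_apply, Module.End.one_apply, Pi.add_apply, Pi.smul_apply, smul_eq_mul]
  have e : (c ∘ Equiv.swap p r) ∘ Equiv.swap p r = c := by funext j; simp
  rw [e]
  simp only [Function.comp_apply, Equiv.swap_apply_left, Equiv.swap_apply_right, a1, b1]
  rcases lt_trichotomy (c p) (c r) with h | h | h
  · simp [h.ne, h.ne', h, h.not_gt]; ring
  · simp [h]; field_simp; ring
  · simp [h.ne, h.ne', h, h.not_gt]; ring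

lemma Kop_quad (Q : k) (hQ : Q ≠ 0) (n : ℕ) {d : ℕ} (p : Fin d) :
    Kop Q n p * Kop Q n p = 1 + (Q⁻¹ - Q) • Kop Q n p := by
  refine LinearMap.ext fun F => funext fun c => ?_
  simp only [Kop, Module.End.mul_apply, Op_apply, LinearMap.add_apply,
    LinearMap.smul_apply, Module.End.one_apply, Pi.add_apply, Pi.smul_apply, smul_eq_mul]
  simp only [Function.update_self, Function.update_idem, Fin.rev_rev, Function.update_eq_self,
    a0, b0, val_rev]
  rcases lt_trichotomy (val n (c p)) 0 with h | h | h
  · simp [h.ne, h, h.not_gt]; ring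
  · simp [h]; field_simp; ring
  · simp [h.ne', h, h.not_gt]; ring

lemma Kop_Rop (Q q : k) (n : ℕ) {d : ℕ} (u p r : Fin d) (h1 : u ≠ p) (h2 : u ≠ r) :
    Kop Q n u * Rop q n p r = Rop q n p r * Kop Q n u := by
  refine LinearMap.ext fun F => funext fun c => ?_
  simp only [Rop, Kop, Module.End.mul_apply, Op_apply]
  have e : (Function.update c u (Fin.rev (c u))) ∘ Equiv.swap p r =
      Function.update (c ∘ Equiv.swap p r) u (Fin.rev (c u)) := by
    funext j
    by_cases hj : j = u
    · subst hj; simp [Equiv.swap_apply_of_ne_of_ne h1 h2]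
    · have : Equiv.swap p r j ≠ u := by
        intro h; apply hj
        rw [← Equiv.swap_apply_of_ne_of_ne h1 h2] at h
        exact (Equiv.swap p r).injective h
      simp [hj, this]
  simp only [e, Function.comp_apply, Equiv.swap_apply_of_ne_of_ne h1 h2,
    Function.update_of_ne h1.symm, Function.update_of_ne h2.symm]
  ring

lemma Rop_Rop (q : k) (n : ℕ) {d : ℕ} (u v p r : Fin d) (h1 : u ≠ p) (h2 : u ≠ r)
    (h3 : v ≠ p) (h4 : v ≠ r) :
    Rop q n u v * Rop q n p r = Rop q n p r * Rop q n u v := by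
  refine LinearMap.ext fun F => funext fun c => ?_
  simp only [Rop, Module.End.mul_apply, Op_apply]
  have e : (c ∘ Equiv.swap u v) ∘ Equiv.swap p r = (c ∘ Equiv.swap p r) ∘ Equiv.swap u v := by
    funext j
    simp only [Function.comp_apply, Equiv.swap_apply_def]
    grind
  simp only [e, Function.comp_apply, Equiv.swap_apply_of_ne_of_ne h1 h2,
    Equiv.swap_apply_of_ne_of_ne h3 h4, Equiv.swap_apply_of_ne_of_ne h1.symm h3.symm,
    Equiv.swap_apply_of_ne_of_ne h2.symm h4.symm]
  ring

lemma Rop_braid (q : k) (hq : q ≠ 0) (n : ℕ) {d : ℕ} (p r t : Fin d) (h1 : p ≠ r) (h2 : r ≠ t)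
    (h3 : p ≠ t) :
    Rop q n p r * Rop q n r t * Rop q n p r = Rop q n r t * Rop q n p r * Rop q n r t := by
  refine LinearMap.ext fun F => funext fun c => ?_
  simp only [Rop, Module.End.mul_apply, Op_apply]
  obtain ⟨g, hg⟩ : ∃ g : Fin n → Fin n → Fin n → (Fin d → Fin n), g = fun u v w =>
    Function.update (Function.update (Function.update c p u) r v) t w := ⟨_, rfl⟩
  have gp : ∀ u v w, g u v w p = u := by intros; simp [hg, h1, h3]
  have gr : ∀ u v w, g u v w r = v := by intros; simp [hg, h2]
  have gt : ∀ u v w, g u v w t = w := by intros; simp [hg]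
  have g1 : ∀ u v w, g u v w ∘ Equiv.swap p r = g v u w := by
    intros; funext j
    simp only [hg, Function.comp_apply, Equiv.swap_apply_def, Function.update_apply]
    grind
  have g2 : ∀ u v w, g u v w ∘ Equiv.swap r t = g u w v := by
    intros; funext j
    simp only [hg, Function.comp_apply, Equiv.swap_apply_def, Function.update_apply]
    grind
  have gc : c = g (c p) (c r) (c t) := by simp [hg]
  rw [gc]
  generalize c p = x
  generalize c r = y
  generalize c t = z
  simp only [g1, g2, gp, gr, gt]
  clear gc hg g1 g2 gp gr gt
  simp only [a1, b1, Fin.ext_iff, Fin.lt_def]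
  rcases lt_trichotomy x y with h | h | h <;>
  rcases lt_trichotomy y z with h' | h' | h' <;>
  rcases lt_trichotomy x z with h'' | h'' | h'' <;>
  first
  | (exfalso; omega)
  | (try subst h
     try subst h'
     try subst h''
     simp (disch := omega) only [if_pos, if_neg, if_true]
     try field_simp
     try ring)

lemma KR_braid (Q q : k) (hQ : Q ≠ 0) (hq : q ≠ 0) (n : ℕ) {d : ℕ} (p r : Fin d) (h1 : p ≠ r) :
    Kop Q n p * (Rop q n p r * Kop Q n p * Rop q n p r) =
      (Rop q n p r * Kop Q n p * Rop q n p r) * Kop Q n p := by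
  refine LinearMap.ext fun F => funext fun c => ?_
  simp only [Rop, Kop, Module.End.mul_apply, Op_apply]
  obtain ⟨g, hg⟩ : ∃ g : Fin n → Fin n → (Fin d → Fin n), g = fun u v =>
    (Function.update (Function.update c p u) r v) := ⟨_, rfl⟩
  have gp : ∀ u v, g u v p = u := by intros; simp [hg, h1]
  have gr : ∀ u v, g u v r = v := by intros; simp [hg]
  have g1 : ∀ u v, g u v ∘ Equiv.swap p r = g v u := by
    intros; funext j
    simp only [hg, Function.comp_apply, Equiv.swap_apply_def, Function.update_apply]
    grind
  have g2 : ∀ u v w, Function.update (g u v) p w = g w v := by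
    intros; funext j
    simp only [hg, Function.update_apply]
    grind
  have gc : c = g (c p) (c r) := by simp [hg]
  rw [gc]
  generalize c p = x
  generalize c r = y
  simp only [g1, g2, gp, gr, Fin.rev_rev]
  clear gc hg g1 g2 gp gr
  simp only [a0, b0, a1, b1, val_inj, val_lt, val_rev]
  have hx0 : val n x = 0 → x.rev = x := by intro h; rw [val_inj, val_rev]; omega
  have hy0 : val n y = 0 → y.rev = y := by intro h; rw [val_inj, val_rev]; omega
  have hxy : val n x = val n y → y = x := by intro h; rw [val_inj]; omega
  have hxy' : val n x = - val n y → y = x.rev := by intro h; rw [val_inj, val_rev]; omega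
  rcases lt_trichotomy (val n x) 0 with h | h | h <;>
  rcases lt_trichotomy (val n y) 0 with h' | h' | h' <;>
  rcases lt_trichotomy (val n x) (val n y) with k1 | k1 | k1 <;>
  rcases lt_trichotomy (val n x) (-val n y) with k2 | k2 | k2 <;>
  first
  | (exfalso; omega)
  | (simp (disch := omega) only [if_pos, if_neg]
     try rw [hx0 h]
     try rw [hy0 h']
     try rw [hxy k1]
     try rw [hxy' k2]
     try rw [Fin.rev_rev]
     try field_simp
     try ring)
lemma TB_quad (Q q : k) (hq : q ≠ 0) (n d i : ℕ) (h0 : i ≠ 0) (hi : i < d) :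
    TB Q q n d i * TB Q q n d i = 1 + (q⁻¹ - q) • TB Q q n d i := by
  rw [TB_pos Q q n d i h0 hi]; exact Rop_quad q hq n _ _

lemma TB_comm (Q q : k) (n d i j : ℕ) (hij : i + 2 ≤ j) (hj : j < d) :
    Commute (TB Q q n d i) (TB Q q n d j) := by
  rw [TB_pos Q q n d j (by omega) hj]
  by_cases h : i = 0
  · subst h
    rw [TB_zero Q q n d (by omega)]
    apply Kop_Rop <;> simp [Fin.ext_iff] <;> omega
  · rw [TB_pos Q q n d i h (by omega)]
    apply Rop_Rop <;> simp [Fin.ext_iff] <;> omega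

lemma TB_braid (Q q : k) (hq : q ≠ 0) (n d i : ℕ) (hi : i + 2 < d) :
    TB Q q n d (i+1) * TB Q q n d (i+2) * TB Q q n d (i+1) =
    TB Q q n d (i+2) * TB Q q n d (i+1) * TB Q q n d (i+2) := by
  rw [TB_pos Q q n d (i+1) (by omega) (by omega), TB_pos Q q n d (i+2) (by omega) (by omega)]
  apply Rop_braid q hq <;> simp [Fin.ext_iff]

lemma JM_comm_TB (Q q : k) (n d j : ℕ) (hj : j < d) : ∀ i, i + 1 ≤ j →
    Commute (JM Q q n d i) (TB Q q n d j)
  | 0, _ => Commute.one_left _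
  | 1, h => TB_comm Q q n d 0 j (by omega) hj
  | i + 2, h => by
    have h1 := TB_comm Q q n d (i+1) j (by omega) hj
    have h2 := JM_comm_TB Q q n d j hj (i+1) (by omega)
    exact (h1.mul_left h2).mul_left h1

lemma JM_succ (Q q : k) (n d i : ℕ) (hi : i ≠ 0) :
    JM Q q n d (i+1) = TB Q q n d i * JM Q q n d i * TB Q q n d i := by
  obtain ⟨m, rfl⟩ := Nat.exists_eq_succ_of_ne_zero hi
  rfl

lemma monoid_comm {M : Type*} [Monoid M] (S T C : M) (h1 : S * T * S = T * S * T)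
    (h2 : Commute C T) (h3 : Commute C (S * C * S)) :
    Commute (S * C * S) (T * (S * C * S) * T) := by
  have h2' : ∀ x, C * (T * x) = T * (C * x) := fun x => by
    rw [← mul_assoc, h2.eq, mul_assoc]
  have h1' : ∀ x, S * (T * (S * x)) = T * (S * (T * x)) := fun x => by
    rw [← mul_assoc, ← mul_assoc, h1]; simp only [mul_assoc]
  have h1'' : S * (T * S) = T * (S * T) := by simpa only [mul_assoc] using h1
  have h3' : C * (S * (C * S)) = S * (C * (S * C)) := by
    have := h3.eq; simpa only [mul_assoc] using this
  have h3'' : ∀ x, C * (S * (C * (S * x))) = S * (C * (S * (C * x))) := fun x => by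
    have := congrArg (· * x) h3'; simpa only [mul_assoc] using this
  show _ = _
  simp only [mul_assoc]
  calc S * (C * (S * (T * (S * (C * (S * T))))))
      = S * (C * (T * (S * (T * (C * (S * T)))))) := by rw [h1']
    _ = S * (T * (C * (S * (C * (T * (S * T)))))) := by rw [h2', h2']
    _ = S * (T * (C * (S * (C * (S * (T * S)))))) := by rw [h1'']
    _ = S * (T * (S * (C * (S * (C * (T * S)))))) := by rw [h3'']
    _ = T * (S * (T * (C * (S * (C * (T * S)))))) := by rw [h1']
    _ = T * (S * (C * (T * (S * (T * (C * S)))))) := by rw [h2', h2']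
    _ = T * (S * (C * (S * (T * (S * (C * S)))))) := by rw [h1']

lemma JM_comm (Q q : k) (hQ : Q ≠ 0) (hq : q ≠ 0) (n d : ℕ) : ∀ i, i + 1 < d →
    Commute (JM Q q n d (i+1)) (JM Q q n d (i+2))
  | 0, h => by
    show TB Q q n d 0 * (TB Q q n d 1 * TB Q q n d 0 * TB Q q n d 1) =
      (TB Q q n d 1 * TB Q q n d 0 * TB Q q n d 1) * TB Q q n d 0
    rw [TB_zero Q q n d (by omega), TB_pos Q q n d 1 (by omega) (by omega)]
    apply KR_braid Q q hQ hq
    simp [Fin.ext_iff]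
  | i + 1, h => by
    have ih := JM_comm Q q hQ hq n d i (by omega)
    exact monoid_comm _ _ _ (TB_braid Q q hq n d i (by omega))
      (JM_comm_TB Q q n d (i+2) (by omega) (i+1) (by omega)) ih

/-- candidate eigenvalues -/
def root (Q q : k) (x : Bool × ℤ) : k :=
  if x.1 then Q⁻¹ * q ^ (2 * x.2) else - Q * q ^ (2 * x.2)

def Idx (i : ℕ) : Finset (Bool × ℤ) := Finset.univ ×ˢ Finset.Icc (-(i:ℤ)) i

lemma quad_eig {V : Type*} [AddCommGroup V] [Module k V] (T : Module.End k V) (q : k) (hq : q ≠ 0)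
    (h : T * T = 1 + (q⁻¹ - q) • T) (v : V) (hv : v ≠ 0) (t : k) (ht : T v = t • v) :
    t = q⁻¹ ∨ t = - q := by
  have h1 := LinearMap.congr_fun h v
  simp only [Module.End.mul_apply, LinearMap.add_apply, Module.End.one_apply, LinearMap.smul_apply,
    ht, map_smul, smul_smul] at h1
  have h2 : (t * t - (1 + (q⁻¹ - q) * t)) • v = 0 := by
    rw [sub_smul, add_smul, one_smul, h1, sub_self]
  have h3 := (smul_eq_zero.1 h2).resolve_right hv
  have h4 : (t - q⁻¹) * (t + q) = 0 := by
    rw [← h3]; field_simp; ring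
  rcases mul_eq_zero.1 h4 with h | h
  · left; exact sub_eq_zero.1 h
  · right; exact eq_neg_of_add_eq_zero_left h

lemma eig_step {V : Type*} [AddCommGroup V] [Module ℂ V] [FiniteDimensional ℂ V]
    (A T : Module.End ℂ V) (q : ℂ) (hq : q ≠ 0)
    (h : T * T = 1 + (q⁻¹ - q) • T) (hc : Commute A (T * A * T)) (b : ℂ)
    (hb : (T * A * T).HasEigenvalue b) :
    ∃ a, A.HasEigenvalue a ∧ (b = a ∨ b = a * q ^ (2:ℤ) ∨ b = a * q ^ (-2:ℤ)) := by
  obtain ⟨a, v, hv, hAv, hBv⟩ : ∃ a : ℂ, ∃ v : V, v ≠ 0 ∧ A v = a • v ∧ (T * A * T) v = b • v := by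
    set W := Module.End.eigenspace (T * A * T) b
    have hmaps : ∀ x ∈ W, A x ∈ W := by
      intro x hx
      rw [Module.End.mem_eigenspace_iff] at hx ⊢
      have := LinearMap.congr_fun hc.eq x
      simp only [Module.End.mul_apply] at this hx ⊢
      rw [← this, hx, map_smul]
    have : Nontrivial W := Submodule.nontrivial_iff_ne_bot.2 hb
    obtain ⟨a, ha⟩ := Module.End.exists_eigenvalue (A.restrict hmaps)
    obtain ⟨w, hw⟩ := ha.exists_hasEigenvector
    refine ⟨a, w, ?_, ?_, ?_⟩
    · simpa using hw.2
    · have := congrArg Subtype.val hw.apply_eq_smul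
      simpa using this
    · exact Module.End.mem_eigenspace_iff.1 w.2
  have hAa : A.HasEigenvalue a :=
    Module.End.hasEigenvalue_of_hasEigenvector (x := v) ⟨Module.End.mem_eigenspace_iff.2 hAv, hv⟩
  by_cases hab : b = a
  · exact ⟨a, hAa, Or.inl hab⟩
  have hab' : a - b ≠ 0 := sub_ne_zero.2 (Ne.symm hab)
  have hATv : A (T v) = b • T v - ((q⁻¹ - q) * b) • v := by
    have h1 := LinearMap.congr_fun h (A (T v))
    have h2 := LinearMap.congr_fun h v
    simp only [Module.End.mul_apply, LinearMap.add_apply, Module.End.one_apply,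
      LinearMap.smul_apply] at h1 h2 hBv
    rw [hBv, map_smul] at h1
    rw [mul_smul, eq_sub_iff_add_eq, ← h1]
  by_cases hu : T v + ((q⁻¹ - q) * b / (a - b)) • v = 0
  · have ht : T v = (-((q⁻¹ - q) * b / (a - b))) • v := by
      rw [neg_smul]; exact eq_neg_of_add_eq_zero_left hu
    have ht' := quad_eig T q hq h v hv _ ht
    generalize (-((q⁻¹ - q) * b / (a - b))) = t at ht ht'
    have hbb : b = a * (t * t) := by
      simp only [Module.End.mul_apply, ht, map_smul, hAv, smul_smul] at hBv
      have : (b - t * (a * t)) • v = 0 := by rw [sub_smul, ← hBv, sub_self]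
      have := (smul_eq_zero.1 this).resolve_right hv
      linear_combination this
    refine ⟨a, hAa, Or.inr ?_⟩
    rcases ht' with rfl | rfl
    · right; rw [hbb]; congr 1
      rw [zpow_neg, zpow_ofNat, pow_two, mul_inv]
    · left; rw [hbb, zpow_ofNat]; ring
  · refine ⟨b, ?_, Or.inl rfl⟩
    refine Module.End.hasEigenvalue_of_hasEigenvector
      (x := T v + ((q⁻¹ - q) * b / (a - b)) • v) ⟨Module.End.mem_eigenspace_iff.2 ?_, hu⟩
    rw [map_add, map_smul, hATv, hAv]
    have : (q⁻¹ - q) * b / (a - b) * a = (q⁻¹ - q) * b / (a - b) * b + (q⁻¹ - q) * b := by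
      field_simp; ring
    rw [smul_smul, this, add_smul, smul_add, smul_smul, mul_comm b]
    abel

lemma JM_eig (Q q : ℂ) (hQ : Q ≠ 0) (hq : q ≠ 0) (n d : ℕ) : ∀ i, i + 1 ≤ d → ∀ μ,
    (JM Q q n d (i+1)).HasEigenvalue μ → ∃ x ∈ Idx i, μ = root Q q x
  | 0, h, μ, hμ => by
    obtain ⟨v, hv⟩ := hμ.exists_hasEigenvector
    have e : JM Q q n d 1 = Kop Q n ⟨0, h⟩ := TB_zero Q q n d h
    rw [zero_add, e] at hv
    rcases quad_eig _ Q hQ (Kop_quad Q hQ n _) v hv.2 μ hv.apply_eq_smul with h | h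
    · exact ⟨(true, 0), by simp [Idx], by simp [root, h]⟩
    · exact ⟨(false, 0), by simp [Idx], by simp [root, h]⟩
  | i + 1, h, μ, hμ => by
    obtain ⟨a, ha, hb⟩ := eig_step _ (TB Q q n d (i+1)) q hq
      (TB_quad Q q hq n d (i+1) (by omega) (by omega)) (JM_comm Q q hQ hq n d i (by omega)) μ hμ
    obtain ⟨⟨e, c⟩, hx, rfl⟩ := JM_eig Q q hQ hq n d i (by omega) a ha
    simp only [Idx, Finset.mem_product, Finset.mem_univ, true_and, Finset.mem_Icc] at hx
    have key : ∀ m : ℤ, root Q q (e, c) * q ^ (2 * m) = root Q q (e, c + m) := by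
      intro m
      cases e <;> simp [root, mul_add, zpow_add₀ hq, mul_assoc]
    rcases hb with rfl | rfl | rfl
    · exact ⟨(e, c), by simp [Idx]; omega, rfl⟩
    · exact ⟨(e, c + 1), by simp [Idx]; omega, key 1⟩
    · exact ⟨(e, c + (-1)), by simp [Idx]; omega, by simpa using key (-1)⟩
open Polynomial in
/-- annihilating polynomial -/
def ann (Q q : k) (s : Finset (Bool × ℤ)) : k[X] := ∏ x ∈ s, (X - C (root Q q x))

def IsSym {X : Type*} [Fintype X] (T : Module.End ℂ (X → ℂ)) : Prop :=
  ∀ f g : X → ℂ, ∑ c, star (T f c) * g c = ∑ c, star (f c) * T g c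

lemma IsSym.Op {X : Type*} [Fintype X] (a b : X → ℂ) (s : X → X) (hs : ∀ c, s (s c) = c)
    (ha : ∀ c, star (a c) = a c) (hb : ∀ c, star (b c) = b c) (hbs : ∀ c, b (s c) = b c) :
    IsSym (Op a b s) := by
  intro f g
  have e := Equiv.sum_comp (⟨s, s, hs, hs⟩ : X ≃ X) (fun c => b c * star (f (s c)) * g c)
  simp only [Equiv.coe_fn_mk, hs, hbs] at e
  simp only [Op_apply, star_add, star_mul', ha, hb, add_mul, mul_add, Finset.sum_add_distrib]
  rw [← e]
  congr 1
  · exact Finset.sum_congr rfl fun c _ => by ring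
  · exact Finset.sum_congr rfl fun c _ => by ring

lemma IsSym.conj {X : Type*} [Fintype X] {S T : Module.End ℂ (X → ℂ)} (hS : IsSym S)
    (hT : IsSym T) : IsSym (T * S * T) := by
  intro f g
  simp only [Module.End.mul_apply]
  rw [hT, hS, hT]

lemma TB_form (Q q : k) (n d i : ℕ) (hi : i < d) :
    ∃ s : (Fin d → Fin n) → (Fin d → Fin n), (∀ c, s (s c) = c) ∧
    ∃ a b : (Fin d → Fin n) → k, TB Q q n d i = Op a b s ∧ (∀ c, b c = 0 ∨ b c = 1) ∧
      (∀ c, b (s c) = b c) ∧ (∀ c, a c = Q⁻¹ ∨ a c = q⁻¹ ∨ a c = Q⁻¹ - Q ∨ a c = q⁻¹ - q ∨ a c = 0) := by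
  by_cases h : i = 0
  · subst h
    rw [TB_zero Q q n d hi]
    refine ⟨_, ?_, _, _, rfl, ?_, ?_, ?_⟩
    · intro c; simp
    · intro c; simp only [b0]; split_ifs <;> simp
    · intro c; simp [b0, val_rev]
    · intro c; simp only [a0]; split_ifs <;> simp
  · rw [TB_pos Q q n d i h hi]
    refine ⟨_, ?_, _, _, rfl, ?_, ?_, ?_⟩
    · intro c; funext j; simp
    · intro c; simp only [b1]; split_ifs <;> simp
    · intro c; simp [b1, eq_comm]
    · intro c; simp only [a1]; split_ifs <;> simp

lemma TB_sym (x y : ℝ) (n d i : ℕ) (hi : i < d) : IsSym (TB (x:ℂ) (y:ℂ) n d i) := by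
  obtain ⟨s, hs, a, b, e, hb, hbs, ha⟩ := TB_form (x:ℂ) (y:ℂ) n d i hi
  rw [e]
  apply IsSym.Op _ _ _ hs _ _ hbs
  · intro c
    rcases ha c with h | h | h | h | h <;> rw [h] <;> simp
  · intro c
    rcases hb c with h | h <;> rw [h] <;> simp

lemma JM_sym (x y : ℝ) (n d : ℕ) : ∀ i, i < d → IsSym (JM (x:ℂ) (y:ℂ) n d (i+1))
  | 0, h => TB_sym x y n d 0 h
  | i + 1, h => (JM_sym x y n d i (by omega)).conj (TB_sym x y n d (i+1) h)

lemma root_real (x y : ℝ) (z : Bool × ℤ) : star (root (x:ℂ) (y:ℂ) z) = root (x:ℂ) (y:ℂ) z := by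
  simp only [root]; split_ifs <;> simp

lemma IsSym.sub {X : Type*} [Fintype X] {S : Module.End ℂ (X → ℂ)} (hS : IsSym S) (μ : ℂ)
    (hμ : star μ = μ) : IsSym (S - μ • 1) := by
  intro f g
  simp only [LinearMap.sub_apply, LinearMap.smul_apply, Module.End.one_apply, Pi.sub_apply,
    Pi.smul_apply, smul_eq_mul, star_sub, star_mul', hμ, sub_mul, mul_sub, Finset.sum_sub_distrib]
  rw [hS]
  congr 1
  exact Finset.sum_congr rfl fun c _ => by ring

open scoped ComplexOrder in
lemma IsSym.ker {X : Type*} [Fintype X] {N : Module.End ℂ (X → ℂ)} (hN : IsSym N)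
    (v : X → ℂ) : ∀ m : ℕ, (N ^ (m+1)) v = 0 → N v = 0
  | 0, h => by simpa using h
  | m + 1, h => by
    apply IsSym.ker hN v m
    rw [pow_succ', pow_succ', Module.End.mul_apply, Module.End.mul_apply] at h
    rw [pow_succ', Module.End.mul_apply]
    generalize (N ^ m) v = w at h
    have h1 := hN w (N w)
    rw [h] at h1
    simp only [Pi.zero_apply, mul_zero, Finset.sum_const_zero] at h1
    exact dotProduct_star_self_eq_zero.1 h1

lemma ann_pos (x y : ℝ) (hx : x ≠ 0) (hy : y ≠ 0) (n d i : ℕ) (hi : i < d) :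
    Polynomial.aeval (JM (x:ℂ) (y:ℂ) n d (i+1)) (ann (x:ℂ) (y:ℂ) (Idx i)) = 0 := by
  set A := JM (x:ℂ) (y:ℂ) n d (i+1) with hA
  rw [← LinearMap.ker_eq_top, eq_top_iff, ← Module.End.iSup_maxGenEigenspace_eq_top A, iSup_le_iff]
  intro μ v hv
  rw [Module.End.mem_maxGenEigenspace] at hv
  obtain ⟨m, hm⟩ := hv
  rw [LinearMap.mem_ker]
  by_cases hμ : A.HasEigenvalue μ
  · obtain ⟨z, hz, rfl⟩ := JM_eig (x:ℂ) (y:ℂ) (by exact_mod_cast hx) (by exact_mod_cast hy) n d i hi μ hμ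
    have h1 := ((JM_sym x y n d i hi).sub _ (root_real x y z)).ker v m
      (by rw [pow_succ', Module.End.mul_apply, hm, map_zero])
    rw [ann, ← Finset.prod_erase_mul _ _ hz, map_mul, Module.End.mul_apply]
    have h2 : Polynomial.aeval A (Polynomial.X - Polynomial.C (root (x:ℂ) (y:ℂ) z)) =
        A - root (x:ℂ) (y:ℂ) z • 1 := by
      simp [Algebra.algebraMap_eq_smul_one]
    rw [h2, h1, map_zero]
  · have hinj : Function.Injective ((A - μ • 1 : Module.End ℂ _)) := by
      rw [← LinearMap.ker_eq_bot]
      by_contra hne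
      apply hμ
      rw [Module.End.hasEigenvalue_iff, Module.End.eigenspace_def]
      exact hne
    have : v = 0 := by
      have h3 : Function.Injective ((A - μ • 1 : Module.End ℂ _) ^ m) := by
        rw [Module.End.coe_pow]; exact hinj.iterate m
      apply h3
      rw [hm, map_zero]
    rw [this, map_zero]

section diff
variable {D : Set ℂ} {Qf qf : ℂ → ℂ}

def DD {X : Type*} (D : Set ℂ) (f : ℂ → X → ℂ) : Prop :=
  ∀ c, DifferentiableOn ℂ (fun t => f t c) D

lemma DD_Rop {n d : ℕ} (p r : Fin d) (f : ℂ → (Fin d → Fin n) → ℂ)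
    (hq : DifferentiableOn ℂ qf D) (hq0 : ∀ t ∈ D, qf t ≠ 0) (hf : DD D f) :
    DD D (fun t => Rop (qf t) n p r (f t)) := by
  intro c
  simp only [Rop, Op_apply, a1]
  refine DifferentiableOn.add (DifferentiableOn.mul ?_ (hf _)) ((hf _).const_mul _)
  split_ifs
  · exact hq.inv hq0
  · exact (hq.inv hq0).sub hq
  · exact differentiableOn_const _

lemma DD_Kop {n d : ℕ} (p : Fin d) (f : ℂ → (Fin d → Fin n) → ℂ)
    (hq : DifferentiableOn ℂ qf D) (hq0 : ∀ t ∈ D, qf t ≠ 0) (hf : DD D f) :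
    DD D (fun t => Kop (qf t) n p (f t)) := by
  intro c
  simp only [Kop, Op_apply, a0]
  refine DifferentiableOn.add (DifferentiableOn.mul ?_ (hf _)) ((hf _).const_mul _)
  split_ifs
  · exact hq.inv hq0
  · exact (hq.inv hq0).sub hq
  · exact differentiableOn_const _

lemma DD_JM (hQ : DifferentiableOn ℂ Qf D) (hq : DifferentiableOn ℂ qf D)
    (hQ0 : ∀ t ∈ D, Qf t ≠ 0) (hq0 : ∀ t ∈ D, qf t ≠ 0) {n d : ℕ} :
    ∀ (i : ℕ), i < d → ∀ (f : ℂ → (Fin d → Fin n) → ℂ), DD D f →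
    DD D (fun t => JM (Qf t) (qf t) n d (i+1) (f t))
  | 0, hi, f, hf => by
    have : ∀ t, JM (Qf t) (qf t) n d (0+1) = Kop (Qf t) n ⟨0, hi⟩ := fun t => TB_zero _ _ n d hi
    simp only [this]
    exact DD_Kop _ f hQ hQ0 hf
  | i + 1, hi, f, hf => by
    have : ∀ t, JM (Qf t) (qf t) n d (i+1+1) = _ := fun t => JM_succ _ _ n d (i+1) (by omega)
    simp only [this, TB_pos _ _ n d (i+1) (by omega) hi, Module.End.mul_apply]
    exact DD_Rop _ _ _ hq hq0 (DD_JM hQ hq hQ0 hq0 i (by omega) _ (DD_Rop _ _ f hq hq0 hf))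

lemma DD_ann (hQ : DifferentiableOn ℂ Qf D) (hq : DifferentiableOn ℂ qf D)
    (hQ0 : ∀ t ∈ D, Qf t ≠ 0) (hq0 : ∀ t ∈ D, qf t ≠ 0) {n d : ℕ}
    (i : ℕ) (hi : i < d) (f : ℂ → (Fin d → Fin n) → ℂ) (hf : DD D f) (s : Finset (Bool × ℤ)) :
    DD D (fun t => Polynomial.aeval (JM (Qf t) (qf t) n d (i+1)) (ann (Qf t) (qf t) s) (f t)) := by
  induction s using Finset.induction_on with
  | empty => simpa [ann] using hf
  | insert x s hx ih =>
    simp only [ann, Finset.prod_insert hx, map_mul, Module.End.mul_apply] at ih ⊢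
    simp only [map_sub, Polynomial.aeval_X, Polynomial.aeval_C, Algebra.algebraMap_eq_smul_one,
      LinearMap.sub_apply, LinearMap.smul_apply, Module.End.one_apply]
    intro c
    simp only [Pi.sub_apply, Pi.smul_apply, smul_eq_mul]
    refine (DD_JM hQ hq hQ0 hq0 i hi _ ih c).sub (DifferentiableOn.mul ?_ (ih c))
    have hz : DifferentiableOn ℂ (fun t => qf t ^ (2 * x.2)) D :=
      fun t ht => (hq t ht).zpow (Or.inl (hq0 t ht))
    simp only [root]
    split_ifs
    · exact (hQ.inv hQ0).mul hz
    · exact hQ.neg.mul hz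
end diff

lemma ident (F : ℂ → ℂ) (hF : DifferentiableOn ℂ F {0}ᶜ) (h : ∀ x : ℝ, x ≠ 0 → F x = 0) :
    ∀ z : ℂ, z ≠ 0 → F z = 0 := by
  have hA : AnalyticOnNhd ℂ F {0}ᶜ := hF.analyticOnNhd isOpen_compl_singleton
  have hc : IsPreconnected ({0}ᶜ : Set ℂ) :=
    (isConnected_compl_singleton_of_one_lt_rank (by simp) 0).isPreconnected
  have hfr : ∃ᶠ z in nhdsWithin (1:ℂ) {1}ᶜ, F z = 0 := by
    have ht : Filter.Tendsto (fun x : ℝ => (x : ℂ)) (nhdsWithin (1:ℝ) {1}ᶜ)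
        (nhdsWithin (1:ℂ) {1}ᶜ) := by
      apply tendsto_nhdsWithin_of_tendsto_nhds_of_eventually_within
      · have := (Complex.continuous_ofReal.tendsto 1).mono_left
          (nhdsWithin_le_nhds (a := (1:ℝ)) (s := {1}ᶜ))
        simpa using this
      · filter_upwards [self_mem_nhdsWithin] with x hx
        simpa using hx
    apply ht.frequently
    apply Filter.Eventually.frequently
    filter_upwards [nhdsWithin_le_nhds (isOpen_ne.mem_nhds (one_ne_zero : (1:ℝ) ≠ 0))] with x hx
    exact h x hx
  intro z hz
  exact hA.eqOn_zero_of_preconnected_of_frequently_eq_zero hc (by simp) hfr hz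

lemma ann_all (Q q : ℂ) (hQ : Q ≠ 0) (hq : q ≠ 0) (n d i : ℕ) (hi : i < d) :
    Polynomial.aeval (JM Q q n d (i+1)) (ann Q q (Idx i)) = 0 := by
  refine LinearMap.ext fun f => funext fun c => ?_
  have h1 : ∀ y : ℝ, y ≠ 0 → ∀ Q : ℂ, Q ≠ 0 →
      Polynomial.aeval (JM Q (y:ℂ) n d (i+1)) (ann Q (y:ℂ) (Idx i)) f c = 0 := by
    intro y hy
    apply ident (fun Q => Polynomial.aeval (JM Q (y:ℂ) n d (i+1)) (ann Q (y:ℂ) (Idx i)) f c)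
    · exact DD_ann (Qf := fun t => t) (qf := fun _ => (y:ℂ)) differentiableOn_id
        (differentiableOn_const _) (fun t ht => ht) (fun _ _ => by exact_mod_cast hy) i hi
        (fun _ => f) (fun c => differentiableOn_const _) (Idx i) c
    · intro x hx
      rw [ann_pos x y hx hy n d i hi]; rfl
  refine ident (fun q => Polynomial.aeval (JM Q q n d (i+1)) (ann Q q (Idx i)) f c) ?_ ?_ q hq
  · exact DD_ann (Qf := fun _ => Q) (qf := fun t => t) (differentiableOn_const _)
        differentiableOn_id (fun _ _ => hQ) (fun t ht => ht) i hi
        (fun _ => f) (fun c => differentiableOn_const _) (Idx i) c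
  · intro y hy
    exact h1 y hy Q hQ

lemma root_inj (Q q : ℂ) (hQ : Q ≠ 0) (hq : q ≠ 0)
    (hgen : ∀ a b : ℤ, (a, b) ≠ (0, 0) → Q ^ a * q ^ b ≠ 1) (x y : Bool × ℤ)
    (h : root Q q x = root Q q y) : x = y := by
  have same : ∀ a b : ℤ, q ^ (2 * a) = q ^ (2 * b) → a = b := by
    intro a b hab
    by_contra hne
    apply hgen 0 (2 * a - 2 * b) (by simp; omega)
    rw [zpow_zero, one_mul, zpow_sub₀ hq, hab, div_self (zpow_ne_zero _ hq)]
  have diffc : ∀ a b : ℤ, Q⁻¹ * q ^ (2 * a) ≠ - Q * q ^ (2 * b) := by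
    intro a b hab
    apply hgen (-4) (4 * a - 4 * b) (by simp)
    have h1 : Q⁻¹ * Q⁻¹ * (q ^ (2 * a - 2 * b)) = -1 := by
      rw [zpow_sub₀ hq]
      have h3 := zpow_ne_zero (2 * b) hq
      field_simp at hab ⊢
      linear_combination hab
    have h2 : Q ^ (-4 : ℤ) * q ^ (4 * a - 4 * b) = (Q⁻¹ * Q⁻¹ * (q ^ (2 * a - 2 * b))) ^ 2 := by
      rw [mul_pow, ← zpow_natCast (q ^ (2 * a - 2 * b)), ← zpow_mul]
      congr 1
      · rw [zpow_neg, zpow_ofNat]; field_simp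
      · congr 1; push_cast; ring
    rw [h2, h1]; norm_num
  obtain ⟨e, a⟩ := x
  obtain ⟨e', b⟩ := y
  cases e <;> cases e' <;> simp only [root, if_true, Bool.false_eq_true, if_false] at h
  · rw [same a b (mul_left_cancel₀ (neg_ne_zero.2 hQ) h)]
  · exact absurd h.symm (diffc b a)
  · exact absurd h (diffc a b)
  · rw [same a b (mul_left_cancel₀ (inv_ne_zero hQ) h)]

/-- Over `ℂ`, for generic parameters `Q, q` (that is,
`Q^a q^b ≠ 1` for all integer pairs `(a,b) ≠ (0,0)`), each Jucys–Murphy operator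
`K_i` (`1 ≤ i ≤ d`) on `V_n^{⊗d}` is diagonalizable: its eigenspaces span the
whole space. -/
theorem JM_diagonalizable
    (Q q : ℂ) (hQ : Q ≠ 0) (hq : q ≠ 0)
    (hgen : ∀ a b : ℤ, (a, b) ≠ (0, 0) → Q ^ a * q ^ b ≠ 1)
    (n d : ℕ) (hn : 1 ≤ n) (hd : 1 ≤ d) (i : ℕ) (hi1 : 1 ≤ i) (hi2 : i ≤ d) :
    (⨆ μ : ℂ, Module.End.eigenspace (JM Q q n d i) μ) = ⊤ := by
  obtain ⟨m, rfl⟩ : ∃ m, i = m + 1 := ⟨i - 1, by omega⟩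
  have h1 := ann_all Q q hQ hq n d m (by omega)
  have h2 : (ann Q q (Idx m)).Separable :=
    Polynomial.separable_prod_X_sub_C_iff'.2 fun x _ y _ h => root_inj Q q hQ hq hgen x y h
  have h3 := Module.End.isSemisimple_of_squarefree_aeval_eq_zero h2.squarefree h1
  rw [← Module.End.iSup_maxGenEigenspace_eq_top (JM Q q n d (m+1))]
  exact iSup_congr fun μ => (h3.isFinitelySemisimple.maxGenEigenspace_eq_eigenspace μ).symm

end QSP
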